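/- (Difference relation from (S₁).) For every integer n ≥ 0 and every index 1 ≤ j ≤ N: r_{n+1,j} + r_{n,j} = (t_j − α_n)·R_{n,j} + γ_j. -/

import Mathlib

open MeasureTheory Polynomial

/-- A product of powers `|x - t i| ^ γ i` with `γ i ≥ 0` is dominated by a polynomial. -/
lemma exists_polynomial_prod_rpow_le {ι : Type*} (s : Finset ι) (t γ : ι → ℝ)
    (hγ : ∀ i, 0 ≤ γ i) :
    ∃ Q : ℝ[X], ∀ x : ℝ, ∏ i ∈ s, |x - t i| ^ γ i ≤ Q.eval x := by
  refine ⟨∏ i ∈ s, (1 + (X - C (t i)) ^ (2 * ⌈γ i⌉₊)), fun x => ?_⟩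
  rw [eval_prod]
  refine Finset.prod_le_prod (fun i _ => by positivity) (fun i _ => ?_)
  simp only [eval_add, eval_one, eval_pow, eval_sub, eval_X, eval_C]
  have habs : (x - t i) ^ (2 * ⌈γ i⌉₊) = |x - t i| ^ (2 * ⌈γ i⌉₊) := by
    rw [pow_mul, pow_mul, sq_abs]
  rw [habs]
  rcases le_total |x - t i| 1 with h1 | h1
  · have := Real.rpow_le_one (abs_nonneg (x - t i)) h1 (hγ i)
    have : 0 ≤ |x - t i| ^ (2 * ⌈γ i⌉₊) := by positivity
    linarith
  · have hexp : γ i ≤ ((2 * ⌈γ i⌉₊ : ℕ) : ℝ) := by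
      push_cast
      linarith [Nat.le_ceil (γ i), hγ i]
    have := Real.rpow_le_rpow_of_exponent_le h1 hexp
    rw [Real.rpow_natCast] at this
    linarith

lemma integrable_eval_mul_exp_neg_sq (p : ℝ[X]) :
    Integrable fun x : ℝ => p.eval x * Real.exp (-x ^ 2) := by
  induction p using Polynomial.induction_on' with
  | add p q hp hq =>
    simp only [eval_add, add_mul]
    exact hp.add hq
  | monomial n a =>
    have := integrable_rpow_mul_exp_neg_mul_sq (b := 1) one_pos (s := n)
      (by have := n.cast_nonneg (α := ℝ); linarith)
    simpa [mul_assoc] using this.const_mul a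

lemma continuous_exp_neg_sq_mul_prod_rpow {ι : Type*} [Fintype ι] (t γ : ι → ℝ)
    (hγ : ∀ i, 0 ≤ γ i) :
    Continuous fun x : ℝ => Real.exp (-x ^ 2) * ∏ i, |x - t i| ^ γ i := by
  refine (by fun_prop : Continuous fun x : ℝ => Real.exp (-x ^ 2)).mul
    (continuous_finsetProd _ fun i _ => ?_)
  exact (by fun_prop : Continuous fun x : ℝ => |x - t i|).rpow_const fun _ => Or.inr (hγ i)

/-- Polynomials are integrable against the weight. -/
lemma integrable_eval_mul_weight {ι : Type*} [Fintype ι] (t γ : ι → ℝ) (hγ : ∀ i, 0 ≤ γ i)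
    (p : ℝ[X]) :
    Integrable fun x : ℝ => p.eval x * (Real.exp (-x ^ 2) * ∏ i, |x - t i| ^ γ i) := by
  obtain ⟨Q, hQ⟩ := exists_polynomial_prod_rpow_le Finset.univ t γ hγ
  refine (integrable_eval_mul_exp_neg_sq (p * Q)).mono
    (p.continuous.mul (continuous_exp_neg_sq_mul_prod_rpow t γ hγ)).aestronglyMeasurable
    (.of_forall fun x => ?_)
  have hprod : 0 ≤ ∏ i, |x - t i| ^ γ i := Finset.prod_nonneg fun i _ => by positivity
  simp only [eval_mul, norm_mul, Real.norm_eq_abs, Real.abs_exp]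
  rw [mul_assoc, mul_comm |Q.eval x|, abs_of_nonneg hprod]
  gcongr
  exact (hQ x).trans (le_abs_self _)

/-- The function `|x - a| ^ s` with `s > -1` is integrable near `a`. -/
lemma integrableOn_abs_sub_rpow (a : ℝ) {s : ℝ} (hs : -1 < s) :
    IntegrableOn (fun x : ℝ => |x - a| ^ s) (Set.Icc (a - 1) (a + 1)) := by
  have hpos : IntervalIntegrable (fun x : ℝ => |x| ^ s) volume 0 1 := by
    refine (intervalIntegral.intervalIntegrable_rpow' hs).congr fun x hx => ?_
    rw [Set.uIoc_of_le zero_le_one] at hx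
    simp [abs_of_pos hx.1]
  have hneg : IntervalIntegrable (fun x : ℝ => |x| ^ s) volume (-1) 0 := by
    simpa using (hpos.comp_sub_left 0).symm
  have := (hneg.trans hpos).comp_sub_right a
  rw [intervalIntegrable_iff_integrableOn_Icc_of_le (by linarith)] at this
  rwa [neg_add_eq_sub, add_comm 1 a] at this

/-- Polynomials divided by `x - t j` are integrable against the weight. -/
lemma integrable_eval_mul_weight_div_sub {ι : Type*} [Fintype ι] (t γ : ι → ℝ)
    (hγ : ∀ i, 0 < γ i) (p : ℝ[X]) (j : ι) :
    Integrable fun x : ℝ =>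
      p.eval x * (Real.exp (-x ^ 2) * ∏ i, |x - t i| ^ γ i) / (x - t j) := by
  classical
  have hγ' : ∀ i, 0 ≤ γ i := fun i => (hγ i).le
  have hcont := p.continuous.mul (continuous_exp_neg_sq_mul_prod_rpow t γ hγ')
  have hmeas : AEStronglyMeasurable (fun x : ℝ =>
      p.eval x * (Real.exp (-x ^ 2) * ∏ i, |x - t i| ^ γ i) / (x - t j)) :=
    (hcont.measurable.div (by fun_prop)).aestronglyMeasurable
  rw [← integrableOn_univ, ← Set.union_compl_self (Set.Icc (t j - 1) (t j + 1))]
  refine IntegrableOn.union ?_ ?_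
  · have hrest : Continuous fun x : ℝ =>
        p.eval x * (Real.exp (-x ^ 2) * ∏ i ∈ Finset.univ.erase j, |x - t i| ^ γ i) := by
      refine p.continuous.mul ((by fun_prop : Continuous fun x : ℝ => Real.exp (-x ^ 2)).mul
        (continuous_finsetProd _ fun i _ => ?_))
      exact (by fun_prop : Continuous fun x : ℝ => |x - t i|).rpow_const
        fun _ => Or.inr (hγ' i)
    have hdom := (integrableOn_abs_sub_rpow (t j) (s := γ j - 1)
      (by linarith [hγ j])).continuousOn_mul hrest.continuousOn isCompact_Icc
    refine Integrable.mono hdom hmeas.restrict (.of_forall fun x => ?_)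
    rw [← Finset.mul_prod_erase _ _ (Finset.mem_univ j)]
    rcases eq_or_ne x (t j) with rfl | hx
    · simp only [sub_self, div_zero, norm_zero]
      positivity
    · have hx' : 0 < |x - t j| := abs_pos.mpr (sub_ne_zero.mpr hx)
      rw [Real.rpow_sub_one hx'.ne']
      simp only [norm_mul, norm_div, Real.norm_eq_abs, abs_abs]
      exact le_of_eq (by ring)
  · refine Integrable.mono (integrable_eval_mul_weight t γ hγ' p).integrableOn hmeas.restrict ?_
    filter_upwards [ae_restrict_mem measurableSet_Icc.compl] with x hx
    rw [norm_div]
    refine div_le_self (norm_nonneg _) ?_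
    rw [Real.norm_eq_abs]
    by_contra! hlt
    rw [abs_lt] at hlt
    exact hx ⟨by linarith, by linarith⟩

section OrthogonalSequence

variable {L : ℝ[X] →ₗ[ℝ] ℝ} {P : ℕ → ℝ[X]}

lemma degree_sub_C_coeff_mul_lt (hmonic : ∀ n, (P n).Monic) (hdeg : ∀ n, (P n).natDegree = n)
    {m : ℕ} {q : ℝ[X]} (hq : q.degree < ((m + 1 : ℕ) : WithBot ℕ)) :
    (q - C (q.coeff m) * P m).degree < (m : WithBot ℕ) := by
  rw [degree_lt_iff_coeff_zero] at hq ⊢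
  intro k hk
  rw [coeff_sub, coeff_C_mul]
  rcases hk.eq_or_lt with rfl | hlt
  · have : (P m).coeff m = 1 := by simpa [leadingCoeff, hdeg] using (hmonic m).leadingCoeff
    rw [this, mul_one, sub_self]
  · have : (P m).coeff k = 0 := coeff_eq_zero_of_natDegree_lt (by rwa [hdeg])
    rw [hq k hlt, this, mul_zero, sub_zero]

lemma map_mul_eq_zero_of_degree_lt (hmonic : ∀ n, (P n).Monic)
    (hdeg : ∀ n, (P n).natDegree = n) (horth : ∀ m n, m ≠ n → L (P m * P n) = 0) {n : ℕ} (m : ℕ)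
    (hmn : m ≤ n) (q : ℝ[X]) (hq : q.degree < (m : WithBot ℕ)) : L (q * P n) = 0 := by
  induction m generalizing q with
  | zero =>
    have : q = 0 := by simpa using hq
    simp [this]
  | succ m ih =>
    have h1 := ih (by omega) _ (degree_sub_C_coeff_mul_lt hmonic hdeg hq)
    rw [sub_mul, map_sub, mul_assoc, ← smul_eq_C_mul, map_smul, horth m n (by omega)] at h1
    simpa using h1

lemma eq_zero_of_map_mul_eq_zero (hmonic : ∀ n, (P n).Monic)
    (hdeg : ∀ n, (P n).natDegree = n) (horth : ∀ m n, m ≠ n → L (P m * P n) = 0)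
    (hne : ∀ n, L (P n * P n) ≠ 0) (m : ℕ) (q : ℝ[X]) (hq : q.degree < (m : WithBot ℕ))
    (hzero : ∀ i < m, L (q * P i) = 0) : q = 0 := by
  induction m with
  | zero => simpa using hq
  | succ m ih =>
    have hlt := degree_sub_C_coeff_mul_lt hmonic hdeg hq
    have h1 := map_mul_eq_zero_of_degree_lt hmonic hdeg horth m le_rfl _ hlt
    rw [sub_mul, map_sub, mul_assoc, ← smul_eq_C_mul, map_smul, hzero m (by omega)] at h1
    have hc : q.coeff m = 0 := by simpa [hne m] using h1
    rw [hc] at hlt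
    exact ih (by simpa using hlt) fun i hi => hzero i (by omega)

lemma degree_X_mul_sub_lt (hmonic : ∀ n, (P n).Monic) (hdeg : ∀ n, (P n).natDegree = n)
    (n : ℕ) : (X * P n - P (n + 1)).degree < ((n + 1 : ℕ) : WithBot ℕ) := by
  have hd : ∀ k, (P k).degree = (k : WithBot ℕ) := fun k => by
    rw [degree_eq_natDegree (hmonic k).ne_zero, hdeg]
  have hX : (X * P n).degree = ((n + 1 : ℕ) : WithBot ℕ) := by
    rw [degree_mul, degree_X, hd]; push_cast; ring
  have := degree_sub_lt_left (p := X * P n) (q := P (n + 1)) (by rw [hX, hd])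
    (monic_X.mul (hmonic n)).ne_zero
    (by rw [(monic_X.mul (hmonic n)).leadingCoeff, (hmonic _).leadingCoeff])
  rwa [hX] at this

/-- First step of the three-term recurrence of monic orthogonal polynomials. -/
lemma X_mul_zero_eq (hmonic : ∀ n, (P n).Monic)
    (hdeg : ∀ n, (P n).natDegree = n) (horth : ∀ m n, m ≠ n → L (P m * P n) = 0)
    (hne : ∀ n, L (P n * P n) ≠ 0) :
    X * P 0 = P 1 + C (L (X * P 0 * P 0) / L (P 0 * P 0)) * P 0 := by
  have hd : ∀ k, (P k).degree = (k : WithBot ℕ) := fun k => by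
    rw [degree_eq_natDegree (hmonic k).ne_zero, hdeg]
  set a := L (X * P 0 * P 0) / L (P 0 * P 0) with ha
  suffices h : X * P 0 - P 1 - C a * P 0 = 0 by linear_combination h
  refine eq_zero_of_map_mul_eq_zero hmonic hdeg horth hne 1 _ ?_ fun i hi => ?_
  · refine (degree_sub_le _ _).trans_lt (max_lt (degree_X_mul_sub_lt hmonic hdeg 0) ?_)
    rw [← smul_eq_C_mul]
    refine (degree_smul_le _ _).trans_lt ?_
    rw [hd]; norm_num
  · obtain rfl : i = 0 := by omega
    rw [sub_mul, sub_mul, map_sub, map_sub, horth 1 0 (by omega), mul_assoc (C a),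
      ← smul_eq_C_mul, map_smul, smul_eq_mul, ha, div_mul_cancel₀ _ (hne 0)]
    ring

/-- Three-term recurrence of monic orthogonal polynomials. -/
lemma X_mul_succ_eq (hmonic : ∀ n, (P n).Monic)
    (hdeg : ∀ n, (P n).natDegree = n) (horth : ∀ m n, m ≠ n → L (P m * P n) = 0)
    (hne : ∀ n, L (P n * P n) ≠ 0) (n : ℕ) :
    X * P (n + 1) = P (n + 2)
      + C (L (X * P (n + 1) * P (n + 1)) / L (P (n + 1) * P (n + 1))) * P (n + 1)
      + C (L (P (n + 1) * P (n + 1)) / L (P n * P n)) * P n := by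
  have hd : ∀ k, (P k).degree = (k : WithBot ℕ) := fun k => by
    rw [degree_eq_natDegree (hmonic k).ne_zero, hdeg]
  set a := L (X * P (n + 1) * P (n + 1)) / L (P (n + 1) * P (n + 1)) with ha
  set b := L (P (n + 1) * P (n + 1)) / L (P n * P n) with hb
  suffices h : X * P (n + 1) - P (n + 2) - C a * P (n + 1) - C b * P n = 0 by
    linear_combination h
  refine eq_zero_of_map_mul_eq_zero hmonic hdeg horth hne (n + 2) _ ?_ fun i hi => ?_
  · refine (degree_sub_le _ _).trans_lt (max_lt ((degree_sub_le _ _).trans_lt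
      (max_lt (degree_X_mul_sub_lt hmonic hdeg (n + 1)) ?_)) ?_)
    all_goals
      rw [← smul_eq_C_mul]
      refine (degree_smul_le _ _).trans_lt ?_
      rw [hd]
      exact_mod_cast (by omega)
  · have hexpand : L ((X * P (n + 1) - P (n + 2) - C a * P (n + 1) - C b * P n) * P i)
        = L (X * P (n + 1) * P i) - L (P (n + 2) * P i) - a * L (P (n + 1) * P i)
          - b * L (P n * P i) := by
      simp only [sub_mul, map_sub, ← smul_eq_C_mul, smul_mul_assoc, map_smul, smul_eq_mul]
    have hshift : L (X * P (n + 1) * P i)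
        = L ((X * P i - P (i + 1)) * P (n + 1)) + L (P (i + 1) * P (n + 1)) := by
      rw [← map_add]; congr 1; ring
    rw [hexpand, horth (n + 2) i (by omega)]
    rcases (by omega : i = n + 1 ∨ i < n + 1) with rfl | hlt
    · rw [horth n (n + 1) (by omega), ha, div_mul_cancel₀ _ (hne _)]
      ring
    · rw [hshift, map_mul_eq_zero_of_degree_lt hmonic hdeg horth (i + 1) (by omega) _
        (degree_X_mul_sub_lt hmonic hdeg i), horth (n + 1) i (by omega)]
      rcases (by omega : i = n ∨ i < n) with rfl | hlt'
      · rw [hb, div_mul_cancel₀ _ (hne _)]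
        ring
      · rw [horth n i (by omega), horth (i + 1) (n + 1) (by omega)]
        ring

end OrthogonalSequence

/-- Integration of polynomials against a function `w` all of whose moments exist. -/
noncomputable def weightedIntegral (w : ℝ → ℝ)
    (hint : ∀ p : ℝ[X], Integrable fun x => p.eval x * w x) : ℝ[X] →ₗ[ℝ] ℝ where
  toFun p := ∫ x, p.eval x * w x
  map_add' p q := by simp only [eval_add, add_mul, integral_add (hint p) (hint q)]
  map_smul' c p := by simp [mul_assoc, integral_const_mul]

theorem difference_relation_S1
    (N : ℕ) (hN : 1 ≤ N)
    (t γ : Fin N → ℝ) (ht : Function.Injective t) (hγ : ∀ j, 0 < γ j)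
    (w : ℝ → ℝ) (hw : ∀ x : ℝ, w x = Real.exp (-x ^ 2) * ∏ j, |x - t j| ^ γ j)
    (P : ℕ → Polynomial ℝ)
    (hPmonic : ∀ n, (P n).Monic) (hPdeg : ∀ n, (P n).natDegree = n)
    (horth : ∀ m n, m ≠ n → ∫ x : ℝ, (P m).eval x * (P n).eval x * w x = 0)
    (h : ℕ → ℝ) (hh : ∀ n, h n = ∫ x : ℝ, ((P n).eval x) ^ 2 * w x)
    (hhpos : ∀ n, 0 < h n)
    (β : ℕ → ℝ) (hβ0 : β 0 = 0) (hβ : ∀ n, β (n + 1) = h (n + 1) / h n)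
    (α : ℕ → ℝ) (hα : ∀ n, α n = (∫ x : ℝ, x * ((P n).eval x) ^ 2 * w x) / h n)
    (R : ℕ → Fin N → ℝ)
    (hR : ∀ n j, R n j = γ j / h n * ∫ y : ℝ, ((P n).eval y) ^ 2 * w y / (y - t j))
    (r : ℕ → Fin N → ℝ) (hr0 : ∀ j, r 0 j = 0)
    (hr : ∀ n j, r (n + 1) j = γ j / h n * ∫ y : ℝ, (P (n + 1)).eval y * (P n).eval y * w y / (y - t j))
    (n : ℕ) (j : Fin N) :
    r (n + 1) j + r n j = (t j - α n) * R n j + γ j := by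
  have hγ' : ∀ i, 0 ≤ γ i := fun i => (hγ i).le
  have hint : ∀ p : ℝ[X], Integrable fun x => p.eval x * w x := fun p => by
    simpa only [hw] using integrable_eval_mul_weight t γ hγ' p
  have hdiv : ∀ p : ℝ[X], Integrable fun x => p.eval x * (w x / (x - t j)) := fun p => by
    simpa only [hw, mul_div_assoc] using integrable_eval_mul_weight_div_sub t γ hγ p j
  let L := weightedIntegral w hint
  have hL : ∀ p, L p = ∫ x, p.eval x * w x := fun p => rfl
  have horth' : ∀ m n, m ≠ n → L (P m * P n) = 0 := fun m n hmn => by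
    simpa only [hL, eval_mul] using horth m n hmn
  have hhL : ∀ n, L (P n * P n) = h n := fun n => by
    simp only [hL, hh, eval_mul, sq]
  have hne : ∀ n, L (P n * P n) ≠ 0 := fun n => by rw [hhL]; exact (hhpos n).ne'
  have hαL : ∀ n, L (X * P n * P n) / L (P n * P n) = α n := fun n => by
    rw [hα, hhL, hL]
    simp only [eval_mul, eval_X, sq, mul_assoc]
  let K := weightedIntegral (fun x => w x / (x - t j)) hdiv
  have hK : ∀ p, K p = ∫ x, p.eval x * (w x / (x - t j)) := fun p => rfl
  have hcancel : ∀ p : ℝ[X], K ((X - C (t j)) * p) = L p := by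
    intro p
    rw [hL, hK]
    refine integral_congr_ae ?_
    filter_upwards [compl_mem_ae_iff.mpr (measure_singleton (t j))] with x hx
    have : x - t j ≠ 0 := sub_ne_zero.mpr hx
    simp only [eval_mul, eval_sub, eval_X, eval_C]
    field_simp
  have hR' : ∀ n, R n j = γ j / h n * K (P n * P n) := fun n => by
    simp only [hR, hK, eval_mul, sq, mul_div_assoc]
  have hr' : ∀ n, r (n + 1) j = γ j / h n * K (P (n + 1) * P n) := fun n => by
    simp only [hr, hK, eval_mul, mul_div_assoc]
  have h0 := (hhpos n).ne'
  cases n with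
  | zero =>
    have hrec := X_mul_zero_eq hPmonic hPdeg horth' hne
    rw [hαL] at hrec
    have hP : P (0 + 1) * P 0
        = (X - C (t j)) * (P 0 * P 0) + (t j - α 0) • (P 0 * P 0) := by
      simp only [smul_eq_C_mul, C_sub]
      linear_combination (-P 0) * hrec
    rw [hr', hr0, hR', hP, map_add, map_smul, smul_eq_mul, hcancel, hhL]
    field_simp
    ring
  | succ n =>
    have h1 := (hhpos n).ne'
    have hrec := X_mul_succ_eq hPmonic hPdeg horth' hne n
    rw [hαL, hhL, hhL] at hrec
    have hP : P (n + 1 + 1) * P (n + 1)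
        = (X - C (t j)) * (P (n + 1) * P (n + 1))
          + (t j - α (n + 1)) • (P (n + 1) * P (n + 1))
          - (h (n + 1) / h n) • (P (n + 1) * P n) := by
      simp only [smul_eq_C_mul, C_sub]
      linear_combination (-P (n + 1)) * hrec
    rw [hr', hr', hR', hP, map_sub, map_add, map_smul, map_smul, smul_eq_mul, smul_eq_mul, hcancel,
      hhL]
    field_simp
    ring
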